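/- Let k be a field of characteristic zero and (S, t) a wheelspace. Set ᵗⁿ := t^n_{n,n} for n ≥ 1. Then: (i) ᵗⁿ(e_{n−1}(σ)·v·e_{n−1}(τ)) = σ·ᵗⁿ(v)·τ for all σ, τ ∈ S_{n−1} and v ∈ S(n); (ii) ᵗⁿ(ᵗ^{n+1}((n n+1)·v·(n n+1))) = ᵗⁿ(ᵗ^{n+1}(v)) for all v ∈ S(n+1); and (iii) t^n_{j,i}(v) = ᵗⁿ((j … n)⁻¹ · v · (i … n)) for all i, j ∈ {1,…,n} and v ∈ S(n). In particular, (S, ᵗ) is a partial wheelspace, and this assignment is a bijection between wheelspace structures and partial wheelspace structures on a fixed diagonal 𝕊-bimodule S. -/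

import Mathlib

/-- The cycle `(a … b)` inside the group of permutations of `ℕ` (1-indexed):
it sends `j` to `j + 1` for `a ≤ j < b`, sends `b` to `a`, and fixes every
other natural number. -/
def cyc (a b : ℕ) : Equiv.Perm ℕ :=
  ((List.range' a (b - a)).map fun j => Equiv.swap j (j + 1)).prod

/-- Membership in `S_n ⊆ Perm ℕ` (1-indexed): `σ` fixes `0` and all `j > n`. -/
def memS (n : ℕ) (σ : Equiv.Perm ℕ) : Prop :=
  ∀ j : ℕ, j = 0 ∨ n < j → σ j = j

/-- `r^n_i(σ)`, realized inside `Perm ℕ` via the conjugation formula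
`e_{n-1}(r^n_i(σ)) = (σ(i) … n)⁻¹ σ (i … n)` (for `σ ∈ S_n` this agrees with
the defining piecewise formula on `{1,…,n-1}` and fixes everything else). -/
def rP (n i : ℕ) (σ : Equiv.Perm ℕ) : Equiv.Perm ℕ :=
  (cyc (σ i) n)⁻¹ * σ * cyc i n

/-- `l^n_i(σ) := (r^n_i(σ⁻¹))⁻¹`. -/
def lP (n i : ℕ) (σ : Equiv.Perm ℕ) : Equiv.Perm ℕ :=
  (rP n i σ⁻¹)⁻¹

/-- The block transposition `b_{a,b}(1 2) ∈ S_{a+b}` (1-indexed): it sends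
`j ↦ j + b` for `1 ≤ j ≤ a`, `j ↦ j - a` for `a < j ≤ a + b`, and fixes
everything else. -/
def blockT (a b : ℕ) : Equiv.Perm ℕ := cyc 1 (a + b) ^ b

/-- The block-diagonal embedding `s_{n,m} : S_n × S_m → S_{n+m}`: `σ ∈ S_n`
acts on `{1,…,n}` as itself and `σ' ∈ S_m` acts, shifted by `n`, on
`{n+1,…,n+m}`. -/
def sEmb (n m : ℕ) (σ σ' : Equiv.Perm ℕ) : Equiv.Perm ℕ :=
  σ * (blockT m n * σ' * (blockT m n)⁻¹)
/-- A diagonal `𝕊`-bimodule structure on the family of `k`-vector spaces `S`: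
for each `n`, commuting `k`-linear left and right actions of `S_n` on `S n`,
the left action being `σ·v = L n σ v` and the right action `v·τ = R n τ v`
(only the values on permutations belonging to `S_n` are relevant). -/
def IsDiagAction (k : Type) [Field k] (S : ℕ → Type)
    [∀ n, AddCommGroup (S n)] [∀ n, Module k (S n)]
    (L R : ∀ n, Equiv.Perm ℕ → S n →ₗ[k] S n) : Prop :=
  ∀ n : ℕ,
    (∀ v : S n, L n 1 v = v ∧ R n 1 v = v) ∧
    (∀ σ τ : Equiv.Perm ℕ, memS n σ → memS n τ → ∀ v : S n,
      L n (σ * τ) v = L n σ (L n τ v) ∧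
      R n (σ * τ) v = R n τ (R n σ v) ∧
      L n σ (R n τ v) = R n τ (L n σ v))

/-- The family of contractions `t^{n+1}_{j,i} = t n j i : S (n+1) → S n`
(`1 ≤ i, j ≤ n+1`) makes the diagonal `𝕊`-bimodule `S` a wheelspace:
axiom (W.1): `t^n_{j,i}(σ·v·τ) = l^n_j(σ) · t^n_{σ⁻¹(j),τ(i)}(v) · r^n_i(τ)`,
and axiom (W.2): `t^n_{j,i} ∘ t^{n+1}_{ℓ,k} = t^n_{j',i'} ∘ t^{n+1}_{ℓ',k'}`
where `(i',k') = (k-1,i)` if `i < k`, `(i',k') = (k,i+1)` if `k ≤ i`, and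
`(j',ℓ')` is obtained from `(j,ℓ)` by the same rule. -/
def IsWheel (k : Type) [Field k] (S : ℕ → Type)
    [∀ n, AddCommGroup (S n)] [∀ n, Module k (S n)]
    (L R : ∀ n, Equiv.Perm ℕ → S n →ₗ[k] S n)
    (t : ∀ n : ℕ, ℕ → ℕ → (S (n + 1) →ₗ[k] S n)) : Prop :=
  (∀ n i j : ℕ, 1 ≤ i → i ≤ n + 1 → 1 ≤ j → j ≤ n + 1 →
    ∀ σ τ : Equiv.Perm ℕ, memS (n + 1) σ → memS (n + 1) τ → ∀ v : S (n + 1),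
      t n j i (L (n + 1) σ (R (n + 1) τ v)) =
        L n (lP (n + 1) j σ) (R n (rP (n + 1) i τ) (t n (σ⁻¹ j) (τ i) v))) ∧
  (∀ n i j a b : ℕ, 1 ≤ i → i ≤ n + 1 → 1 ≤ j → j ≤ n + 1 →
    1 ≤ a → a ≤ n + 2 → 1 ≤ b → b ≤ n + 2 → ∀ v : S (n + 2),
      t n j i (t (n + 1) b a v) =
        t n (if j < b then b - 1 else b) (if i < a then a - 1 else a)
          (t (n + 1) (if j < b then j else j + 1) (if i < a then i else i + 1) v))
/-- The family of partial contractions `ᵗ^{n+1} = pt n : S (n+1) → S n` makes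
the diagonal `𝕊`-bimodule `S` a partial wheelspace:
`ᵗⁿ(e_{n-1}(σ)·v·e_{n-1}(τ)) = σ·ᵗⁿ(v)·τ` for `σ, τ ∈ S_{n-1}` (the embedding
`e_{n-1} : S_{n-1} → S_n` being the obvious inclusion in `Perm ℕ`), and
`ᵗⁿ(ᵗ^{n+1}((n n+1)·v·(n n+1))) = ᵗⁿ(ᵗ^{n+1}(v))`. -/
def IsPartialWheel (k : Type) [Field k] (S : ℕ → Type)
    [∀ n, AddCommGroup (S n)] [∀ n, Module k (S n)]
    (L R : ∀ n, Equiv.Perm ℕ → S n →ₗ[k] S n)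
    (pt : ∀ n : ℕ, S (n + 1) →ₗ[k] S n) : Prop :=
  (∀ (n : ℕ) (σ τ : Equiv.Perm ℕ), memS n σ → memS n τ → ∀ v : S (n + 1),
      pt n (L (n + 1) σ (R (n + 1) τ v)) = L n σ (R n τ (pt n v))) ∧
  (∀ (n : ℕ) (v : S (n + 2)),
      pt n (pt (n + 1)
          (L (n + 2) (Equiv.swap (n + 1) (n + 2))
            (R (n + 2) (Equiv.swap (n + 1) (n + 2)) v))) =
        pt n (pt (n + 1) v))

theorem cyc_self (a : ℕ) : cyc a a = 1 := by simp [cyc]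

theorem cyc_succ_right {a b : ℕ} (h : a ≤ b) :
    cyc a (b + 1) = cyc a b * Equiv.swap b (b + 1) := by
  obtain ⟨d, rfl⟩ := Nat.exists_eq_add_of_le h
  simp [cyc, show a + d + 1 - a = d + 1 by omega, List.range'_concat]

theorem cyc_apply {a b : ℕ} (h : a ≤ b) (x : ℕ) :
    cyc a b x = if x < a ∨ b < x then x else if x = b then a else x + 1 := by
  induction b, h using Nat.le_induction generalizing x with
  | base => rw [cyc_self, Equiv.Perm.one_apply]; split_ifs <;> omega
  | succ b hb ih =>
    rw [cyc_succ_right hb, Equiv.Perm.mul_apply, Equiv.swap_apply_def]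
    split_ifs <;> rw [ih] <;> split_ifs <;> omega

theorem cyc_apply_right {a b : ℕ} (h : a ≤ b) : cyc a b b = a := by
  rw [cyc_apply h]; split_ifs <;> omega

theorem memS.mul {n : ℕ} {σ τ : Equiv.Perm ℕ} (hσ : memS n σ) (hτ : memS n τ) :
    memS n (σ * τ) := fun j hj => by
  rw [Equiv.Perm.mul_apply, hτ j hj, hσ j hj]

theorem memS.inv {n : ℕ} {σ : Equiv.Perm ℕ} (hσ : memS n σ) : memS n σ⁻¹ := fun j hj => by
  rw [Equiv.Perm.inv_eq_iff_eq, hσ j hj]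

theorem memS.succ {n : ℕ} {σ : Equiv.Perm ℕ} (hσ : memS n σ) : memS (n + 1) σ :=
  fun j hj => hσ j (by omega)

theorem memS.of_fix {n : ℕ} {σ : Equiv.Perm ℕ} (hσ : memS (n + 1) σ)
    (h : σ (n + 1) = n + 1) : memS n σ := fun j hj => by
  by_cases hjn : j = n + 1
  · rw [hjn, h]
  · exact hσ j (by omega)

theorem memS.apply_mem {n i : ℕ} {σ : Equiv.Perm ℕ} (hσ : memS n σ) (h₁ : 1 ≤ i) (h₂ : i ≤ n) :
    1 ≤ σ i ∧ σ i ≤ n := by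
  by_contra h
  have := σ.injective (hσ (σ i) (by omega))
  omega

theorem memS_swap (n : ℕ) : memS (n + 2) (Equiv.swap (n + 1) (n + 2)) := fun j hj =>
  Equiv.swap_apply_of_ne_of_ne (by omega) (by omega)

theorem memS_cyc {a n : ℕ} (h₁ : 1 ≤ a) (h₂ : a ≤ n) : memS n (cyc a n) := fun j hj => by
  rw [cyc_apply h₂, if_pos (by omega)]

theorem lP_eq (n i : ℕ) (σ : Equiv.Perm ℕ) :
    lP n i σ = (cyc i n)⁻¹ * σ * cyc (σ⁻¹ i) n := by
  simp [lP, rP, mul_assoc]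

theorem memS_rP {n i : ℕ} {σ : Equiv.Perm ℕ} (hσ : memS (n + 1) σ) (h₁ : 1 ≤ i)
    (h₂ : i ≤ n + 1) : memS n (rP (n + 1) i σ) := by
  obtain ⟨h₃, h₄⟩ := hσ.apply_mem h₁ h₂
  refine memS.of_fix (((memS_cyc h₃ h₄).inv.mul hσ).mul (memS_cyc h₁ h₂)) ?_
  rw [rP, Equiv.Perm.mul_apply, Equiv.Perm.mul_apply, cyc_apply_right h₂,
    Equiv.Perm.inv_eq_iff_eq, cyc_apply_right h₄]

theorem memS_lP {n i : ℕ} {σ : Equiv.Perm ℕ} (hσ : memS (n + 1) σ) (h₁ : 1 ≤ i)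
    (h₂ : i ≤ n + 1) : memS n (lP (n + 1) i σ) :=
  (memS_rP hσ.inv h₁ h₂).inv

/-- If `σ` fixes `n`, then `r^n_n(σ)` is `σ` itself. -/
theorem rP_of_fix {n : ℕ} {σ : Equiv.Perm ℕ} (h : σ n = n) : rP n n σ = σ := by
  simp [rP, h, cyc_self]

theorem lP_of_fix {n : ℕ} {σ : Equiv.Perm ℕ} (h : σ n = n) : lP n n σ = σ := by
  rw [lP, rP_of_fix (by rw [Equiv.Perm.inv_eq_iff_eq, h]), inv_inv]

theorem rP_cyc {a n : ℕ} (h : a ≤ n) : rP n n (cyc a n) = 1 := by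
  simp [rP, cyc_apply_right h, cyc_self]

theorem lP_cyc_inv {a n : ℕ} (h : a ≤ n) : lP n n (cyc a n)⁻¹ = 1 := by
  rw [lP, inv_inv, rP_cyc h, inv_one]

theorem cyc_succ_self (n : ℕ) : cyc n (n + 1) = Equiv.swap n (n + 1) := by
  rw [cyc_succ_right le_rfl, cyc_self, one_mul]

/-- Exchanging the order in which two points are moved to the end of `{1,…,n+2}` amounts to
the transposition of the last two points. -/
theorem cyc_mul_cyc_mul_swap {n a i : ℕ} (ha : a ≤ n + 2) (hi : i ≤ n + 1) :
    cyc a (n + 2) * cyc i (n + 1) * Equiv.swap (n + 1) (n + 2) =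
      cyc (if i < a then i else i + 1) (n + 2) * cyc (if i < a then a - 1 else a) (n + 1) := by
  have h₁ : (if i < a then i else i + 1) ≤ n + 2 := by split_ifs <;> omega
  have h₂ : (if i < a then a - 1 else a) ≤ n + 1 := by split_ifs <;> omega
  ext x
  simp only [Equiv.Perm.mul_apply]
  rw [cyc_apply ha, cyc_apply hi, cyc_apply h₁, cyc_apply h₂, Equiv.swap_apply_def]
  grind

section

variable {k : Type} [Field k] {S : ℕ → Type} [∀ n, AddCommGroup (S n)] [∀ n, Module k (S n)]
  {L R : ∀ n, Equiv.Perm ℕ → S n →ₗ[k] S n}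

theorem IsDiagAction.one_one (h : IsDiagAction k S L R) (n : ℕ) (v : S n) :
    L n 1 (R n 1 v) = v := by
  rw [((h n).1 _).1, ((h n).1 _).2]

theorem IsDiagAction.comp (h : IsDiagAction k S L R) {n : ℕ} {σ σ' τ τ' : Equiv.Perm ℕ}
    (hσ : memS n σ) (hσ' : memS n σ') (hτ : memS n τ) (hτ' : memS n τ') (v : S n) :
    L n σ (R n τ (L n σ' (R n τ' v))) = L n (σ * σ') (R n (τ' * τ) v) := by
  rw [((h n).2 σ σ' hσ hσ' _).1, ((h n).2 τ' τ hτ' hτ _).2.1, ((h n).2 σ' τ hσ' hτ _).2.2]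

/-- The contractions `t^n_{j,i}(v) = ᵗⁿ((j … n)⁻¹ · v · (i … n))` induced by a family of
partial contractions. -/
def contractionOfPartial (L R : ∀ n, Equiv.Perm ℕ → S n →ₗ[k] S n)
    (pt : ∀ n : ℕ, S (n + 1) →ₗ[k] S n) (n j i : ℕ) : S (n + 1) →ₗ[k] S n :=
  pt n ∘ₗ L (n + 1) (cyc j (n + 1))⁻¹ ∘ₗ R (n + 1) (cyc i (n + 1))

theorem IsWheel.eq_last (hLR : IsDiagAction k S L R)
    {t : ∀ n : ℕ, ℕ → ℕ → (S (n + 1) →ₗ[k] S n)} (hw : IsWheel k S L R t) {n i j : ℕ}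
    (hi₁ : 1 ≤ i) (hi₂ : i ≤ n + 1) (hj₁ : 1 ≤ j) (hj₂ : j ≤ n + 1) (v : S (n + 1)) :
    t n j i v =
      t n (n + 1) (n + 1)
        (L (n + 1) (cyc j (n + 1))⁻¹ (R (n + 1) (cyc i (n + 1)) v)) := by
  rw [hw.1 n (n + 1) (n + 1) (by omega) le_rfl (by omega) le_rfl _ _
    (memS_cyc hj₁ hj₂).inv (memS_cyc hi₁ hi₂), inv_inv, cyc_apply_right hj₂,
    cyc_apply_right hi₂, lP_cyc_inv hj₂, rP_cyc hi₂, hLR.one_one]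

theorem IsWheel.isPartialWheel (hLR : IsDiagAction k S L R)
    {t : ∀ n : ℕ, ℕ → ℕ → (S (n + 1) →ₗ[k] S n)} (hw : IsWheel k S L R t) :
    IsPartialWheel k S L R (fun n => t n (n + 1) (n + 1)) := by
  refine ⟨fun n σ τ hσ hτ v => ?_, fun n v => ?_⟩
  · have hσn : σ (n + 1) = n + 1 := hσ _ (by omega)
    have hτn : τ (n + 1) = n + 1 := hτ _ (by omega)
    have hσn' : σ⁻¹ (n + 1) = n + 1 := hσ.inv _ (by omega)
    dsimp only
    rw [hw.1 n (n + 1) (n + 1) (by omega) le_rfl (by omega) le_rfl _ _ hσ.succ hτ.succ,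
      lP_of_fix hσn, rP_of_fix hτn, hσn', hτn]
  · have hlast := hw.eq_last hLR (n := n + 1) (i := n + 1) (j := n + 1)
      (by omega) (by omega) (by omega) (by omega) v
    rw [cyc_succ_self, Equiv.swap_inv] at hlast
    dsimp only
    rw [← hlast, hw.2 n (n + 1) (n + 1) (n + 1) (n + 1) (by omega) le_rfl (by omega) le_rfl
      (by omega) (by omega) (by omega) (by omega)]
    simp

theorem IsPartialWheel.isWheel (hLR : IsDiagAction k S L R)
    {pt : ∀ n : ℕ, S (n + 1) →ₗ[k] S n} (hp : IsPartialWheel k S L R pt) :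
    IsWheel k S L R (contractionOfPartial L R pt) := by
  refine ⟨fun n i j hi₁ hi₂ hj₁ hj₂ σ τ hσ hτ v => ?_,
    fun n i j a b hi₁ hi₂ hj₁ hj₂ ha₁ ha₂ hb₁ hb₂ v => ?_⟩
  · obtain ⟨hσj₁, hσj₂⟩ := hσ.inv.apply_mem hj₁ hj₂
    obtain ⟨hτi₁, hτi₂⟩ := hτ.apply_mem hi₁ hi₂
    have hl := memS_lP hσ hj₁ hj₂
    have hr := memS_rP hτ hi₁ hi₂
    simp only [contractionOfPartial, LinearMap.comp_apply]
    rw [← hp.1 n _ _ hl hr,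
      hLR.comp (memS_cyc hj₁ hj₂).inv hσ (memS_cyc hi₁ hi₂) hτ,
      hLR.comp hl.succ (memS_cyc hσj₁ hσj₂).inv hr.succ (memS_cyc hτi₁ hτi₂), lP_eq, rP]
    simp only [mul_assoc, mul_inv_cancel, mul_one, mul_inv_cancel_left]
  · have hcomp : ∀ {i j a b : ℕ}, 1 ≤ i → i ≤ n + 1 → 1 ≤ j → j ≤ n + 1 → 1 ≤ a → a ≤ n + 2 →
        1 ≤ b → b ≤ n + 2 →
        contractionOfPartial L R pt n j i (contractionOfPartial L R pt (n + 1) b a v) =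
          pt n (pt (n + 1) (L (n + 2) (cyc b (n + 2) * cyc j (n + 1))⁻¹
            (R (n + 2) (cyc a (n + 2) * cyc i (n + 1)) v))) := by
      intro i j a b hi₁ hi₂ hj₁ hj₂ ha₁ ha₂ hb₁ hb₂
      simp only [contractionOfPartial, LinearMap.comp_apply]
      rw [← hp.1 (n + 1) _ _ (memS_cyc hj₁ hj₂).inv (memS_cyc hi₁ hi₂),
        hLR.comp (memS_cyc hj₁ hj₂).inv.succ (memS_cyc hb₁ hb₂).inv
          (memS_cyc hi₁ hi₂).succ (memS_cyc ha₁ ha₂), mul_inv_rev]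
    rw [hcomp hi₁ hi₂ hj₁ hj₂ ha₁ ha₂ hb₁ hb₂,
      hcomp (by split_ifs <;> omega) (by split_ifs <;> omega) (by split_ifs <;> omega)
        (by split_ifs <;> omega) (by split_ifs <;> omega) (by split_ifs <;> omega)
        (by split_ifs <;> omega) (by split_ifs <;> omega),
      ← cyc_mul_cyc_mul_swap ha₂ hi₂, ← cyc_mul_cyc_mul_swap hb₂ hj₂, ← hp.2 n,
      hLR.comp (memS_swap n) ((memS_cyc hb₁ hb₂).mul (memS_cyc hj₁ hj₂).succ).inv
        (memS_swap n) ((memS_cyc ha₁ ha₂).mul (memS_cyc hi₁ hi₂).succ),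
      mul_inv_rev (cyc b (n + 2) * cyc j (n + 1)), Equiv.swap_inv]

theorem contractionOfPartial_last (hLR : IsDiagAction k S L R)
    (pt : ∀ n : ℕ, S (n + 1) →ₗ[k] S n) (n : ℕ) :
    contractionOfPartial L R pt n (n + 1) (n + 1) = pt n := by
  ext v
  simp only [contractionOfPartial, LinearMap.comp_apply]
  rw [cyc_self, inv_one, hLR.one_one]

end

/-- Lemma (wheelspaces give partial wheelspaces, and the two notions are
equivalent):  let `(S, t)` be a wheelspace and set `ᵗⁿ := t^n_{n,n}`.  Then
(i) `ᵗⁿ(e_{n-1}(σ)·v·e_{n-1}(τ)) = σ·ᵗⁿ(v)·τ`;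
(ii) `ᵗⁿ(ᵗ^{n+1}((n n+1)·v·(n n+1))) = ᵗⁿ(ᵗ^{n+1}(v))`
— i.e. `(S, ᵗ)` is a partial wheelspace — and
(iii) `t^n_{j,i}(v) = ᵗⁿ((j … n)⁻¹ · v · (i … n))` for all `1 ≤ i, j ≤ n`.
Moreover the assignment `t ↦ ᵗ` is a bijection between wheelspace structures
and partial wheelspace structures on the fixed diagonal `𝕊`-bimodule `S`:
every partial wheelspace structure arises from a wheelspace structure, and two
wheelspace structures with the same associated partial contractions have the
same contractions `t^n_{j,i}` for all `1 ≤ i, j ≤ n`. -/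
theorem wheelspace_equiv_partialWheelspace (k : Type) [Field k] (S : ℕ → Type)
    [∀ n, AddCommGroup (S n)] [∀ n, Module k (S n)]
    (L R : ∀ n, Equiv.Perm ℕ → S n →ₗ[k] S n)
    (hLR : IsDiagAction k S L R)
    (t : ∀ n : ℕ, ℕ → ℕ → (S (n + 1) →ₗ[k] S n))
    (hw : IsWheel k S L R t) :
    IsPartialWheel k S L R (fun n => t n (n + 1) (n + 1)) ∧
    (∀ n i j : ℕ, 1 ≤ i → i ≤ n + 1 → 1 ≤ j → j ≤ n + 1 → ∀ v : S (n + 1),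
        t n j i v =
          t n (n + 1) (n + 1)
            (L (n + 1) (cyc j (n + 1))⁻¹ (R (n + 1) (cyc i (n + 1)) v))) ∧
    (∀ pt : ∀ n : ℕ, S (n + 1) →ₗ[k] S n, IsPartialWheel k S L R pt →
        ∃ t' : ∀ n : ℕ, ℕ → ℕ → (S (n + 1) →ₗ[k] S n),
          IsWheel k S L R t' ∧ ∀ n : ℕ, t' n (n + 1) (n + 1) = pt n) ∧
    (∀ t₁ t₂ : ∀ n : ℕ, ℕ → ℕ → (S (n + 1) →ₗ[k] S n),
        IsWheel k S L R t₁ → IsWheel k S L R t₂ →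
        (∀ n : ℕ, t₁ n (n + 1) (n + 1) = t₂ n (n + 1) (n + 1)) →
        ∀ n i j : ℕ, 1 ≤ i → i ≤ n + 1 → 1 ≤ j → j ≤ n + 1 →
          t₁ n j i = t₂ n j i) := by
  refine ⟨hw.isPartialWheel hLR,
    fun n i j hi₁ hi₂ hj₁ hj₂ v => hw.eq_last hLR hi₁ hi₂ hj₁ hj₂ v,
    fun pt hp => ⟨contractionOfPartial L R pt, hp.isWheel hLR, contractionOfPartial_last hLR pt⟩,
    fun t₁ t₂ h₁ h₂ h n i j hi₁ hi₂ hj₁ hj₂ => ?_⟩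
  ext v
  rw [h₁.eq_last hLR hi₁ hi₂ hj₁ hj₂, h₂.eq_last hLR hi₁ hi₂ hj₁ hj₂, h n]
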